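/- Let n ≥ 1, T > 0, D a real diagonal n×n matrix, and Σ₀, Σ_T ∈ S⁺⁺ⁿ. If Σ_T ∈ R(Σ₀, D, T), then both majorizations hold: log λ(Σ_T) ≺ log λ(Σ₀)↓ + 2T·λ(D)↓ and log λ(Σ₀) ≺ log λ(Σ_T)↓ + 2T·λ(−D)↓, where λ(−D)↓ is the decreasingly sorted vector of the negatives of the diagonal entries of D. -/

import Mathlib

open MeasureTheory Matrix

/-- The entries of `v` sorted in decreasing order. -/
noncomputable def sortDesc {n : ℕ} (v : Fin n → ℝ) : Fin n → ℝ :=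
  fun i => v (Tuple.sort v i.rev)

/-- `x` is majorized by `y`. -/
def IsMajorizedBy {n : ℕ} (x y : Fin n → ℝ) : Prop :=
  (∑ i, x i = ∑ i, y i) ∧
  ∀ k : ℕ, k < n →
    ∑ i ∈ Finset.univ.filter (fun i : Fin n => (i : ℕ) < k), sortDesc x i ≤
    ∑ i ∈ Finset.univ.filter (fun i : Fin n => (i : ℕ) < k), sortDesc y i

/-- `ΣT` is reachable from `Σ₀` under isospectral control with spectrum `D` in time `T`. -/
noncomputable def IsReachable {n : ℕ} (P₀ PT D : Matrix (Fin n) (Fin n) ℝ) (T : ℝ) : Prop :=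
  ∃ U S : ℝ → Matrix (Fin n) (Fin n) ℝ,
    (∀ i j, Measurable fun t => U t i j) ∧
    (∀ t ∈ Set.Icc (0:ℝ) T, U t * (U t)ᵀ = 1) ∧
    (∀ t ∈ Set.Icc (0:ℝ) T, (S t).PosDef) ∧
    S 0 = P₀ ∧ S T = PT ∧
    (∀ i j, IntervalIntegrable
        (fun t => ((U t * D * (U t)ᵀ) * S t + S t * (U t * D * (U t)ᵀ)) i j)
        MeasureTheory.volume 0 T) ∧
    (∀ t ∈ Set.Icc (0:ℝ) T, ∀ i j,
      S t i j = P₀ i j +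
        ∫ s in (0:ℝ)..t, ((U s * D * (U s)ᵀ) * S s + S s * (U s * D * (U s)ᵀ)) i j)

/-- The sum of the `k` largest entries of `v`. -/
noncomputable def sumLargest {n : ℕ} (k : ℕ) (v : Fin n → ℝ) : ℝ :=
  ∑ i ∈ Finset.univ.filter (fun i : Fin n => (i : ℕ) < k), sortDesc v i

lemma sortDesc_antitone {n : ℕ} (v : Fin n → ℝ) : Antitone (sortDesc v) := by
  intro i j h
  exact Tuple.monotone_sort v (Fin.rev_le_rev.mpr h)

lemma sum_sortDesc {n : ℕ} (v : Fin n → ℝ) : ∑ i, sortDesc v i = ∑ i, v i :=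
  Equiv.sum_comp (Fin.revPerm.trans (Tuple.sort v)) v

lemma card_filter_val_lt {n k : ℕ} (hk : k < n) :
    (Finset.univ.filter (fun i : Fin n => (i : ℕ) < k)).card = k := by
  rw [Fin.card_filter_val_lt]
  omega

lemma sum_mul_le_sumLargest {n k : ℕ} (hk : k < n) (v w : Fin n → ℝ)
    (h0 : ∀ i, 0 ≤ w i) (h1 : ∀ i, w i ≤ 1) (hw : ∑ i, w i = k) :
    ∑ i, w i * v i ≤ sumLargest k v := by
  set e : Equiv.Perm (Fin n) := Fin.revPerm.trans (Tuple.sort v) with he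
  set c := sortDesc v ⟨k, hk⟩ with hc
  have hve : ∀ i, v (e i) = sortDesc v i := fun i => rfl
  rw [← Equiv.sum_comp e] at hw ⊢
  have key : ∑ i, w (e i) * (sortDesc v i - c) ≤
      ∑ i ∈ Finset.univ.filter (fun i : Fin n => (i : ℕ) < k), (sortDesc v i - c) := by
    rw [Finset.sum_filter]
    refine Finset.sum_le_sum fun i _ => ?_
    split_ifs with hi
    · have : c ≤ sortDesc v i := sortDesc_antitone v (Fin.le_def.mpr hi.le)
      nlinarith [h1 (e i)]
    · have : sortDesc v i ≤ c := sortDesc_antitone v (Fin.le_def.mpr (not_lt.mp hi))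
      nlinarith [h0 (e i)]
  simp only [mul_sub, Finset.sum_sub_distrib, ← Finset.sum_mul, hw, Finset.sum_const,
    card_filter_val_lt hk, nsmul_eq_mul] at key
  simp only [hve]
  unfold sumLargest
  linarith

lemma exists_sum_eq_sumLargest {n k : ℕ} (hk : k < n) (v : Fin n → ℝ) :
    ∃ K : Finset (Fin n), K.card = k ∧ ∑ i ∈ K, v i = sumLargest k v := by
  refine ⟨(Finset.univ.filter (fun i : Fin n => (i : ℕ) < k)).map
    (Fin.revPerm.trans (Tuple.sort v)).toEmbedding, ?_, ?_⟩
  · rw [Finset.card_map, card_filter_val_lt hk]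
  · rw [Finset.sum_map]
    rfl

lemma sum_filter_le_sumLargest {n k : ℕ} (hk : k < n) (v : Fin n → ℝ) :
    ∑ i ∈ Finset.univ.filter (fun i : Fin n => (i : ℕ) < k), v i ≤ sumLargest k v := by
  have := sum_mul_le_sumLargest hk v (fun i => if (i : ℕ) < k then 1 else 0)
    (fun i => by positivity) (fun i => by split_ifs <;> norm_num)
    (by rw [← Finset.sum_filter, Finset.sum_const, card_filter_val_lt hk]; simp)
  simpa [Finset.sum_filter] using this

lemma sum_row_sq_eq_one {n : ℕ} {R : Matrix (Fin n) (Fin n) ℝ} (h : R * Rᵀ = 1) (a : Fin n) :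
    ∑ j, R a j ^ 2 = 1 := by
  have := congrFun (congrFun h a) a
  simpa [Matrix.mul_apply, sq] using this

lemma sum_col_sq_eq_one {n : ℕ} {R : Matrix (Fin n) (Fin n) ℝ} (h : R * Rᵀ = 1) (j : Fin n) :
    ∑ a, R a j ^ 2 = 1 := by
  have h' : Rᵀ * Rᵀᵀ = 1 := by simpa using mul_eq_one_comm.mp h
  simpa using sum_row_sq_eq_one h' j

lemma abs_entry_le_one {n : ℕ} {R : Matrix (Fin n) (Fin n) ℝ} (h : R * Rᵀ = 1) (a j : Fin n) :
    |R a j| ≤ 1 := by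
  have h1 := sum_row_sq_eq_one h a
  have h2 : R a j ^ 2 ≤ ∑ j, R a j ^ 2 :=
    Finset.single_le_sum (f := fun j => R a j ^ 2) (fun i _ => sq_nonneg _) (Finset.mem_univ j)
  rw [← sq_le_one_iff_abs_le_one]
  linarith

lemma sub_sumLargest_le_sum_compl {n k : ℕ} (hk : k < n) {R : Matrix (Fin n) (Fin n) ℝ}
    (h : R * Rᵀ = 1) (v : Fin n → ℝ) {K : Finset (Fin n)} (hK : K.card = k) :
    ∑ i, v i - sumLargest k v ≤ ∑ j ∈ Kᶜ, ∑ a, R a j ^ 2 * v a := by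
  have h1 : ∑ j ∈ K, ∑ a, R a j ^ 2 * v a ≤ sumLargest k v := by
    rw [Finset.sum_comm]
    simp only [← Finset.sum_mul]
    refine sum_mul_le_sumLargest hk v _ (fun a => Finset.sum_nonneg fun j _ => sq_nonneg _)
      (fun a => ?_) ?_
    · rw [← sum_row_sq_eq_one h a]
      exact Finset.sum_le_sum_of_subset_of_nonneg (Finset.subset_univ _)
        fun j _ _ => sq_nonneg _
    · rw [Finset.sum_comm]
      simp [sum_col_sq_eq_one h, hK]
  have h2 : ∑ j, ∑ a, R a j ^ 2 * v a = ∑ i, v i := by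
    rw [Finset.sum_comm]
    simp [← Finset.sum_mul, sum_row_sq_eq_one h]
  have h3 := Finset.sum_add_sum_compl K fun j => ∑ a, R a j ^ 2 * v a
  linarith

lemma conj_diagonal_apply_self {n : ℕ} (V Q : Matrix (Fin n) (Fin n) ℝ) (v : Fin n → ℝ)
    (j : Fin n) :
    (Vᵀ * (Q * diagonal v * Qᵀ) * V) j j = ∑ a, (Qᵀ * V) a j ^ 2 * v a := by
  have : Vᵀ * (Q * diagonal v * Qᵀ) * V = (Qᵀ * V)ᵀ * diagonal v * (Qᵀ * V) := by
    simp [Matrix.mul_assoc, Matrix.transpose_mul]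
  rw [this, Matrix.mul_apply]
  refine Finset.sum_congr rfl fun a _ => ?_
  rw [Matrix.mul_diagonal, Matrix.transpose_apply]
  ring

lemma transpose_mul_orthogonal {n : ℕ} {V Q : Matrix (Fin n) (Fin n) ℝ}
    (hV : V * Vᵀ = 1) (hQ : Q * Qᵀ = 1) : (Qᵀ * V) * (Qᵀ * V)ᵀ = 1 := by
  rw [Matrix.transpose_mul, Matrix.transpose_transpose, Matrix.mul_assoc, ← Matrix.mul_assoc V,
    hV, Matrix.one_mul]
  exact mul_eq_one_comm.mp hQ

lemma exists_orthogonal_diagonalization {n : ℕ} {P : Matrix (Fin n) (Fin n) ℝ}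
    (hP : P.IsHermitian) :
    ∃ V : Matrix (Fin n) (Fin n) ℝ, V * Vᵀ = 1 ∧ P = V * diagonal hP.eigenvalues * Vᵀ := by
  refine ⟨hP.eigenvectorUnitary, ?_, ?_⟩
  · have := Unitary.mul_star_self_of_mem hP.eigenvectorUnitary.2
    rwa [Matrix.star_eq_conjTranspose, Matrix.conjTranspose_eq_transpose_of_trivial] at this
  · have := hP.spectral_theorem
    rw [Unitary.conjStarAlgAut_apply, Matrix.star_eq_conjTranspose,
      Matrix.conjTranspose_eq_transpose_of_trivial] at this
    exact this

/-- Logarithms of the eigenvalues, summed over all but the `k` largest. -/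
noncomputable def sumSmallLog {n : ℕ} (k : ℕ) {P : Matrix (Fin n) (Fin n) ℝ}
    (hP : P.IsHermitian) : ℝ :=
  ∑ i, Real.log (hP.eigenvalues i) - sumLargest k fun i => Real.log (hP.eigenvalues i)

lemma sumSmallLog_le_sum_log {n k : ℕ} (hk : k < n) {Q V : Matrix (Fin n) (Fin n) ℝ}
    (hQ : Q.PosDef) (hV : V * Vᵀ = 1) {K : Finset (Fin n)} (hK : K.card = k) :
    sumSmallLog k hQ.1 ≤ ∑ j ∈ Kᶜ, Real.log ((Vᵀ * Q * V) j j) := by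
  obtain ⟨W, hW, hQW⟩ := exists_orthogonal_diagonalization hQ.1
  have hR := transpose_mul_orthogonal hV hW
  refine (sub_sumLargest_le_sum_compl hk hR _ hK).trans (Finset.sum_le_sum fun j _ => ?_)
  have : (Vᵀ * Q * V) j j = ∑ a, (Wᵀ * V) a j ^ 2 * hQ.1.eigenvalues a := by
    conv_lhs => rw [hQW]
    exact conj_diagonal_apply_self _ _ _ _
  rw [this]
  exact strictConcaveOn_log_Ioi.concaveOn.le_map_sum (fun a _ => sq_nonneg _)
    (sum_col_sq_eq_one hR j) (fun a _ => hQ.eigenvalues_pos a)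

lemma conj_apply_self_pos {n : ℕ} {Q V : Matrix (Fin n) (Fin n) ℝ}
    (hQ : Q.PosDef) (hV : V * Vᵀ = 1) (j : Fin n) : 0 < (Vᵀ * Q * V) j j := by
  have h := hQ.conjTranspose_mul_mul_same (B := V)
    (Matrix.mulVec_injective_of_isUnit (IsUnit.of_mul_eq_one _ hV))
  rw [Matrix.conjTranspose_eq_transpose_of_trivial] at h
  exact h.diag_pos

lemma sumSmallLog_le_add {n k : ℕ} (hk : k < n) {P Q V : Matrix (Fin n) (Fin n) ℝ}
    (hP : P.PosDef) (hQ : Q.PosDef) (hV : V * Vᵀ = 1) {K : Finset (Fin n)} (hK : K.card = k)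
    (hKl : ∑ j ∈ K, Real.log (hP.1.eigenvalues j) =
      sumLargest k fun j => Real.log (hP.1.eigenvalues j)) :
    sumSmallLog k hQ.1 ≤ sumSmallLog k hP.1 +
      ∑ j ∈ Kᶜ, (hP.1.eigenvalues j)⁻¹ * ((Vᵀ * Q * V) j j - hP.1.eigenvalues j) := by
  refine (sumSmallLog_le_sum_log hk hQ hV hK).trans ?_
  have h3 := Finset.sum_add_sum_compl K fun j => Real.log (hP.1.eigenvalues j)
  have : sumSmallLog k hP.1 = ∑ j ∈ Kᶜ, Real.log (hP.1.eigenvalues j) := by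
    unfold sumSmallLog
    linarith
  rw [this, ← Finset.sum_add_distrib]
  refine Finset.sum_le_sum fun j _ => ?_
  have hl := hP.eigenvalues_pos j
  have hq := conj_apply_self_pos hQ hV j
  have h := Real.log_le_sub_one_of_pos (div_pos hq hl)
  rw [Real.log_div hq.ne' hl.ne'] at h
  have e : (hP.1.eigenvalues j)⁻¹ * ((Vᵀ * Q * V) j j - hP.1.eigenvalues j)
      = (Vᵀ * Q * V) j j / hP.1.eigenvalues j - 1 := by
    field_simp
  linarith

lemma sub_le_of_forall_sub_le_sq {H : ℝ → ℝ} {T c C : ℝ} (hT : 0 < T)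
    (h : ∀ s t, 0 ≤ s → s ≤ t → t ≤ T → H s - H t ≤ c * (t - s) + C * (t - s) ^ 2) :
    H 0 - H T ≤ c * T := by
  have hN : ∀ N : ℕ, H 0 - H T ≤ c * T + C * T ^ 2 / (N + 1 : ℝ) := by
    intro N
    have hN0 : (0 : ℝ) < N + 1 := by positivity
    have hs := Finset.sum_range_sub' (fun i : ℕ => H (i * (T / (N + 1)))) (N + 1)
    have hb : ∀ i ∈ Finset.range (N + 1),
        H (i * (T / (N + 1))) - H (((i + 1 : ℕ) : ℝ) * (T / (N + 1))) ≤
          c * (T / (N + 1)) + C * (T / (N + 1)) ^ 2 := by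
      intro i hi
      have hi' : ((i : ℝ) + 1) ≤ N + 1 := by exact_mod_cast Finset.mem_range.mp hi
      have hd : 0 < T / (N + 1 : ℝ) := by positivity
      have := h (i * (T / (N + 1))) (((i + 1 : ℕ) : ℝ) * (T / (N + 1))) (by positivity)
        (by push_cast; nlinarith) (by
          push_cast
          calc ((i : ℝ) + 1) * (T / (N + 1)) ≤ (N + 1) * (T / (N + 1)) := by gcongr
            _ = T := by field_simp)
      have e : ((i + 1 : ℕ) : ℝ) * (T / (N + 1)) - i * (T / (N + 1)) = T / (N + 1) := by
        push_cast; ring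
      rwa [e] at this
    have := Finset.sum_le_sum hb
    rw [hs] at this
    have e1 : ((N + 1 : ℕ) : ℝ) * (T / (N + 1)) = T := by push_cast; field_simp
    rw [e1] at this
    simp only [Finset.sum_const, Finset.card_range, nsmul_eq_mul, Nat.cast_zero, zero_mul] at this
    refine this.trans (le_of_eq ?_)
    push_cast
    field_simp
  have hlim : Filter.Tendsto (fun N : ℕ => c * T + C * T ^ 2 / (N + 1 : ℝ)) Filter.atTop
      (nhds (c * T + 0)) := by
    refine tendsto_const_nhds.add ?_
    have := (tendsto_one_div_add_atTop_nhds_zero_nat (𝕜 := ℝ)).const_mul (C * T ^ 2)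
    simpa [mul_one_div, div_eq_mul_inv] using this
  have := ge_of_tendsto' hlim hN
  simpa using this

lemma abs_mul_apply_le {n : ℕ} {X Y : Matrix (Fin n) (Fin n) ℝ} {x y : ℝ}
    (hX : ∀ i j, |X i j| ≤ x) (hY : ∀ i j, |Y i j| ≤ y) (i j : Fin n) :
    |(X * Y) i j| ≤ n * (x * y) := by
  rw [Matrix.mul_apply]
  calc |∑ a, X i a * Y a j| ≤ ∑ a, |X i a * Y a j| := Finset.abs_sum_le_sum_abs _ _
    _ ≤ ∑ _a : Fin n, x * y := by
        refine Finset.sum_le_sum fun a _ => ?_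
        rw [abs_mul]
        exact mul_le_mul (hX i a) (hY a j) (abs_nonneg _) ((abs_nonneg _).trans (hX i a))
    _ = n * (x * y) := by simp

lemma abs_orthogonal_conj_apply_le {n : ℕ} {V X : Matrix (Fin n) (Fin n) ℝ} {x : ℝ}
    (hV : V * Vᵀ = 1) (hX : ∀ i j, |X i j| ≤ x) (i j : Fin n) :
    |(Vᵀ * X * V) i j| ≤ n * (n * x) := by
  have h := abs_mul_apply_le (abs_mul_apply_le (X := Vᵀ) (x := 1)
    (fun a b => abs_entry_le_one hV b a) hX) (abs_entry_le_one hV) i j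
  simpa using h

lemma exists_entry_bound {n : ℕ} {M : ℝ → Matrix (Fin n) (Fin n) ℝ} {a b : ℝ}
    (h : ContinuousOn M (Set.Icc a b)) :
    ∃ C, 0 ≤ C ∧ ∀ t ∈ Set.Icc a b, ∀ i j, |M t i j| ≤ C := by
  have hij : ∀ i j, ∃ C, ∀ t ∈ Set.Icc a b, ‖M t i j‖ ≤ C := fun i j =>
    isCompact_Icc.exists_bound_of_continuousOn
      (continuousOn_pi.mp (continuousOn_pi.mp h i) j)
  choose C hC using hij
  refine ⟨∑ i, ∑ j, |C i j|, by positivity, fun t ht i j => ?_⟩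
  calc |M t i j| ≤ |C i j| := (hC i j t ht).trans (le_abs_self _)
    _ ≤ ∑ j, |C i j| :=
        Finset.single_le_sum (f := fun j => |C i j|) (fun _ _ => abs_nonneg _) (Finset.mem_univ j)
    _ ≤ ∑ i, ∑ j, |C i j| :=
        Finset.single_le_sum (f := fun i => ∑ j, |C i j|)
          (fun _ _ => by positivity) (Finset.mem_univ i)

lemma continuousOn_inv_of_posDef {n : ℕ} {M : ℝ → Matrix (Fin n) (Fin n) ℝ} {s : Set ℝ}
    (h : ContinuousOn M s) (hM : ∀ t ∈ s, (M t).PosDef) :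
    ContinuousOn (fun t => (M t)⁻¹) s := by
  simp only [Matrix.inv_def, Ring.inverse_eq_inv']
  refine ContinuousOn.smul (ContinuousOn.inv₀ ?_ fun t ht => (hM t ht).det_pos.ne') ?_
  · exact (continuous_id.matrix_det).comp_continuousOn h
  · exact (continuous_id.matrix_adjugate).comp_continuousOn h

lemma linearMap_apply_eq_sum {n : ℕ} (f : Matrix (Fin n) (Fin n) ℝ →ₗ[ℝ] ℝ)
    (X : Matrix (Fin n) (Fin n) ℝ) : f X = ∑ i, ∑ j, X i j * f (single i j 1) := by
  conv_lhs => rw [Matrix.matrix_eq_sum_single X]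
  simp only [map_sum]
  refine Finset.sum_congr rfl fun i _ => Finset.sum_congr rfl fun j _ => ?_
  rw [← smul_eq_mul, ← map_smul, Matrix.smul_single, smul_eq_mul, mul_one]

lemma intervalIntegrable_fun_sum {ι : Type*} {g : ι → ℝ → ℝ} {s t : ℝ} (J : Finset ι)
    (h : ∀ i ∈ J, IntervalIntegrable (g i) volume s t) :
    IntervalIntegrable (fun r => ∑ i ∈ J, g i r) volume s t := by
  have := IntervalIntegrable.sum J h
  rwa [Finset.sum_fn] at this

lemma intervalIntegrable_linearMap {n : ℕ} {F : ℝ → Matrix (Fin n) (Fin n) ℝ} {s t : ℝ}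
    (hF : ∀ i j, IntervalIntegrable (fun r => F r i j) volume s t)
    (f : Matrix (Fin n) (Fin n) ℝ →ₗ[ℝ] ℝ) :
    IntervalIntegrable (fun r => f (F r)) volume s t := by
  rw [funext fun r => linearMap_apply_eq_sum f (F r)]
  exact intervalIntegrable_fun_sum _ fun i _ => intervalIntegrable_fun_sum _ fun j _ =>
    (hF i j).mul_const _

lemma linearMap_sub_eq_integral {n : ℕ} {F : ℝ → Matrix (Fin n) (Fin n) ℝ} {s t : ℝ}
    (hF : ∀ i j, IntervalIntegrable (fun r => F r i j) volume s t)
    {X Y : Matrix (Fin n) (Fin n) ℝ} (h : ∀ i j, Y i j - X i j = ∫ r in s..t, F r i j)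
    (f : Matrix (Fin n) (Fin n) ℝ →ₗ[ℝ] ℝ) :
    f Y - f X = ∫ r in s..t, f (F r) := by
  rw [funext fun r => linearMap_apply_eq_sum f (F r), linearMap_apply_eq_sum f Y,
    linearMap_apply_eq_sum f X, intervalIntegral.integral_finsetSum fun i _ => intervalIntegrable_fun_sum _ fun j _ =>
    (hF i j).mul_const _, ← Finset.sum_sub_distrib]
  refine Finset.sum_congr rfl fun i _ => ?_
  rw [intervalIntegral.integral_finsetSum fun j _ => (hF i j).mul_const _,
    ← Finset.sum_sub_distrib]
  refine Finset.sum_congr rfl fun j _ => ?_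
  rw [intervalIntegral.integral_mul_const, ← h, sub_mul]

/-- `X ↦ ∑ j ∈ J, w j * (Vᵀ X V) j j`. -/
noncomputable def weightedDiag {n : ℕ} (J : Finset (Fin n)) (w : Fin n → ℝ)
    (V : Matrix (Fin n) (Fin n) ℝ) : Matrix (Fin n) (Fin n) ℝ →ₗ[ℝ] ℝ where
  toFun X := ∑ j ∈ J, w j * (Vᵀ * X * V) j j
  map_add' X Y := by
    simp [Matrix.add_mul, mul_add, Finset.sum_add_distrib]
  map_smul' c X := by
    simp [Finset.mul_sum, mul_left_comm]

lemma weightedDiag_lower_bound {n k : ℕ} (hk : k < n) {P S U V : Matrix (Fin n) (Fin n) ℝ}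
    {d μ : Fin n → ℝ} {a b e : ℝ} (ha : ∀ i j, |(U * diagonal d * Uᵀ) i j| ≤ a)
    (hU : U * Uᵀ = 1) (hV : V * Vᵀ = 1) (hP : P = V * diagonal μ * Vᵀ)
    (hμ : ∀ j, 0 < μ j) (hb : ∀ j, (μ j)⁻¹ ≤ b) (hE : ∀ i j, |S i j - P i j| ≤ e)
    {K : Finset (Fin n)} (hK : K.card = k) :
    2 * (∑ i, d i - sumLargest k d) - n * (b * (n * (n * (n * (a * e) + n * (e * a))))) ≤
      weightedDiag Kᶜ (fun j => (μ j)⁻¹) V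
        ((U * diagonal d * Uᵀ) * S + S * (U * diagonal d * Uᵀ)) := by
  set A := U * diagonal d * Uᵀ with hA
  set E := S - P with hEdef
  have hn : 0 < n := by omega
  have hV' : Vᵀ * V = 1 := mul_eq_one_comm.mp hV
  set q := (n : ℝ) * (n * (n * (a * e) + n * (e * a))) with hq
  have hXb : ∀ j, |(Vᵀ * (A * E + E * A) * V) j j| ≤ q := by
    intro j
    refine abs_orthogonal_conj_apply_le hV (fun i j => ?_) j j
    refine (abs_add_le _ _).trans (add_le_add ?_ ?_)
    · exact abs_mul_apply_le ha hE i j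
    · exact abs_mul_apply_le hE ha i j
  have hq0 : 0 ≤ q := (abs_nonneg _).trans (hXb ⟨0, hn⟩)
  have hb0 : 0 < b := (inv_pos.mpr (hμ ⟨0, hn⟩)).trans_le (hb ⟨0, hn⟩)
  have hPV : P * V = V * diagonal μ := by rw [hP, Matrix.mul_assoc, hV', Matrix.mul_one]
  have hVP : Vᵀ * P = diagonal μ * Vᵀ := by
    rw [hP, ← Matrix.mul_assoc, ← Matrix.mul_assoc, hV', Matrix.one_mul]
  have hterm : ∀ j, (μ j)⁻¹ * (Vᵀ * (A * S + S * A) * V) j j =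
      2 * (Vᵀ * A * V) j j + (μ j)⁻¹ * (Vᵀ * (A * E + E * A) * V) j j := by
    intro j
    have hS : S = P + E := by rw [hEdef]; abel
    have e1 : Vᵀ * (A * S + S * A) * V =
        (Vᵀ * A * V) * diagonal μ + diagonal μ * (Vᵀ * A * V) + Vᵀ * (A * E + E * A) * V := by
      have e2 : (Vᵀ * A * V) * diagonal μ = Vᵀ * (A * P) * V := by
        simp only [Matrix.mul_assoc, hPV]
      have e3 : diagonal μ * (Vᵀ * A * V) = Vᵀ * (P * A) * V := by
        rw [← Matrix.mul_assoc Vᵀ P A, hVP]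
        simp only [Matrix.mul_assoc]
      rw [e2, e3, hS]
      noncomm_ring
    rw [e1, Matrix.add_apply, Matrix.add_apply, Matrix.mul_diagonal, Matrix.diagonal_mul]
    have := (hμ j).ne'
    field_simp
    ring
  have hw : weightedDiag Kᶜ (fun j => (μ j)⁻¹) V (A * S + S * A) =
      2 * ∑ j ∈ Kᶜ, (Vᵀ * A * V) j j +
        ∑ j ∈ Kᶜ, (μ j)⁻¹ * (Vᵀ * (A * E + E * A) * V) j j := by
    rw [Finset.mul_sum, ← Finset.sum_add_distrib]
    exact Finset.sum_congr rfl fun j _ => hterm j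
  have h1 : ∑ i, d i - sumLargest k d ≤ ∑ j ∈ Kᶜ, (Vᵀ * A * V) j j := by
    simp only [hA, conj_diagonal_apply_self]
    exact sub_sumLargest_le_sum_compl hk (transpose_mul_orthogonal hV hU) d hK
  have h2 : |∑ j ∈ Kᶜ, (μ j)⁻¹ * (Vᵀ * (A * E + E * A) * V) j j| ≤ n * (b * q) := by
    calc _ ≤ ∑ j ∈ Kᶜ, |(μ j)⁻¹ * (Vᵀ * (A * E + E * A) * V) j j| :=
          Finset.abs_sum_le_sum_abs _ _
      _ ≤ ∑ _j ∈ Kᶜ, b * q := by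
          refine Finset.sum_le_sum fun j _ => ?_
          rw [abs_mul, abs_of_pos (inv_pos.mpr (hμ j))]
          exact mul_le_mul (hb j) (hXb j) (abs_nonneg _) hb0.le
      _ ≤ ∑ _j : Fin n, b * q :=
          Finset.sum_le_sum_of_subset_of_nonneg (Finset.subset_univ _)
            fun _ _ _ => by positivity
      _ = n * (b * q) := by simp
  rw [hw]
  have := neg_le_of_abs_le h2
  linarith

lemma inv_eigenvalue_le {n : ℕ} {P V : Matrix (Fin n) (Fin n) ℝ} {μ : Fin n → ℝ} {B : ℝ}
    (hV : V * Vᵀ = 1) (hP : P = V * diagonal μ * Vᵀ) (hμ : ∀ j, 0 < μ j)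
    (hB : ∀ i j, |P⁻¹ i j| ≤ B) (j : Fin n) : (μ j)⁻¹ ≤ n * (n * B) := by
  have hV' : Vᵀ * V = 1 := mul_eq_one_comm.mp hV
  have hinv : P⁻¹ = V * diagonal (fun j => (μ j)⁻¹) * Vᵀ := by
    refine Matrix.inv_eq_right_inv ?_
    have : diagonal μ * diagonal (fun j => (μ j)⁻¹) = 1 := by
      rw [Matrix.diagonal_mul_diagonal, ← Matrix.diagonal_one]
      congr 1
      ext j
      exact mul_inv_cancel₀ (hμ j).ne'
    calc P * (V * diagonal (fun j => (μ j)⁻¹) * Vᵀ)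
        = V * diagonal μ * (Vᵀ * V) * diagonal (fun j => (μ j)⁻¹) * Vᵀ := by
          rw [hP]; simp only [Matrix.mul_assoc]
      _ = V * (diagonal μ * diagonal (fun j => (μ j)⁻¹)) * Vᵀ := by
          rw [hV']; simp only [Matrix.mul_assoc, Matrix.one_mul]
      _ = 1 := by rw [this, Matrix.mul_one, hV]
  have h := abs_orthogonal_conj_apply_le hV hB j j
  have e : Vᵀ * P⁻¹ * V = diagonal fun j => (μ j)⁻¹ := by
    rw [hinv]
    calc _ = (Vᵀ * V) * diagonal (fun j => (μ j)⁻¹) * (Vᵀ * V) := by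
          simp only [Matrix.mul_assoc]
      _ = _ := by rw [hV', Matrix.one_mul, Matrix.mul_one]
  rw [e, Matrix.diagonal_apply_eq] at h
  exact (le_abs_self _).trans h

lemma IsReachable.sumSmallLog_sub_le {n k : ℕ} (hk : k < n) {T : ℝ} (hT : 0 < T)
    {D P₀ PT : Matrix (Fin n) (Fin n) ℝ} (hD : D.IsDiag)
    (hP₀ : P₀.PosDef) (hPT : PT.PosDef) (hreach : IsReachable P₀ PT D T) :
    sumSmallLog k hP₀.1 - sumSmallLog k hPT.1 ≤
      -(2 * (∑ i, D i i - sumLargest k D.diag)) * T := by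
  obtain ⟨U, S, -, hU, hS, rfl, rfl, hint, hSeq⟩ := hreach
  rw [← hD.diagonal_diag] at hint hSeq
  set d := D.diag with hd
  set F : ℝ → Matrix (Fin n) (Fin n) ℝ := fun t =>
    (U t * diagonal d * (U t)ᵀ) * S t + S t * (U t * diagonal d * (U t)ᵀ) with hF
  have hsub : ∀ s t, 0 ≤ s → s ≤ t → t ≤ T →
      ∀ i j, IntervalIntegrable (fun r => F r i j) volume s t := fun s t h0 h1 h2 i j =>
    (hint i j).mono_set (by
      rw [Set.uIcc_of_le h1, Set.uIcc_of_le hT.le]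
      exact Set.Icc_subset_Icc h0 h2)
  have hdiff : ∀ s t, 0 ≤ s → s ≤ t → t ≤ T →
      ∀ i j, S t i j - S s i j = ∫ r in s..t, F r i j := by
    intro s t h0 h1 h2 i j
    rw [hSeq t ⟨h0.trans h1, h2⟩, hSeq s ⟨h0, h1.trans h2⟩, add_sub_add_left_eq_sub]
    exact intervalIntegral.integral_interval_sub_left
      (hsub 0 t le_rfl (h0.trans h1) h2 i j) (hsub 0 s le_rfl h0 (h1.trans h2) i j)
  have hcont : ContinuousOn S (Set.Icc 0 T) := by
    refine continuousOn_pi.mpr fun i => continuousOn_pi.mpr fun j => ?_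
    refine ContinuousOn.congr (f := fun t => S 0 i j + ∫ s in (0 : ℝ)..t, F s i j) ?_
      fun t ht => hSeq t ht i j
    have hi := (intervalIntegrable_iff').mp (hint i j)
    have := intervalIntegral.continuousOn_primitive_interval hi
    rw [Set.uIcc_of_le hT.le] at this
    exact continuousOn_const.add this
  obtain ⟨m, hm0, hm⟩ := exists_entry_bound hcont
  obtain ⟨B, hB0, hB⟩ := exists_entry_bound (continuousOn_inv_of_posDef hcont hS)
  have ha : ∀ t ∈ Set.Icc 0 T, ∀ i j, |(U t * diagonal d * (U t)ᵀ) i j| ≤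
      n * (n * ∑ i, |d i|) := by
    intro t ht i j
    have hU' : (U t)ᵀ * ((U t)ᵀ)ᵀ = 1 := by simpa using mul_eq_one_comm.mp (hU t ht)
    have := abs_orthogonal_conj_apply_le (X := diagonal d) (x := ∑ i, |d i|) hU' (fun i j => by
      by_cases hij : i = j
      · subst hij
        rw [Matrix.diagonal_apply_eq]
        exact Finset.single_le_sum (f := fun i => |d i|) (fun _ _ => abs_nonneg _)
          (Finset.mem_univ i)
      · rw [Matrix.diagonal_apply_ne _ hij, abs_zero]
        positivity) i j
    simpa using this
  set a := (n : ℝ) * (n * ∑ i, |d i|) with hadef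
  set L := (n : ℝ) * (a * m) + n * (m * a) with hL
  have hLip : ∀ s t, 0 ≤ s → s ≤ t → t ≤ T → ∀ i j, |S t i j - S s i j| ≤ L * (t - s) := by
    intro s t h0 h1 h2 i j
    rw [hdiff s t h0 h1 h2, ← abs_of_nonneg (sub_nonneg.mpr h1), ← Real.norm_eq_abs]
    refine intervalIntegral.norm_integral_le_of_norm_le_const fun r hr => ?_
    rw [Set.uIoc_of_le h1] at hr
    have hr' : r ∈ Set.Icc 0 T := ⟨h0.trans hr.1.le, hr.2.trans h2⟩
    exact (abs_add_le _ _).trans (add_le_add (abs_mul_apply_le (ha r hr') (hm r hr') i j)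
      (abs_mul_apply_le (hm r hr') (ha r hr') i j))
  have hL0 : 0 ≤ L := by positivity
  classical
  set H : ℝ → ℝ := fun t => if h : (S t).IsHermitian then sumSmallLog k h else 0 with hH
  have hHt : ∀ t (h : (S t).IsHermitian), H t = sumSmallLog k h := fun t h => dif_pos h
  rw [← hHt, ← hHt]
  refine sub_le_of_forall_sub_le_sq (C := n * (n * (n * B) *
    (n * (n * (n * (a * L) + n * (L * a)))))) hT fun s t h0 h1 h2 => ?_
  have ht : t ∈ Set.Icc 0 T := ⟨h0.trans h1, h2⟩
  have hs : s ∈ Set.Icc 0 T := ⟨h0, h1.trans h2⟩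
  rw [hHt s (hS s hs).1, hHt t (hS t ht).1]
  obtain ⟨V, hV, hSV⟩ := exists_orthogonal_diagonalization (hS t ht).1
  obtain ⟨K, hK, hKl⟩ := exists_sum_eq_sumLargest hk
    fun j => Real.log ((hS t ht).1.eigenvalues j)
  have hstep := sumSmallLog_le_add hk (hS t ht) (hS s hs) hV hK hKl
  set μ := (hS t ht).1.eigenvalues with hμ
  have hμ0 : ∀ j, 0 < μ j := (hS t ht).eigenvalues_pos
  have hV' : Vᵀ * V = 1 := mul_eq_one_comm.mp hV
  have hdiag : ∀ j, (Vᵀ * S t * V) j j = μ j := by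
    intro j
    have : Vᵀ * S t * V = diagonal μ := by
      rw [hSV]
      calc _ = (Vᵀ * V) * diagonal μ * (Vᵀ * V) := by simp only [Matrix.mul_assoc]
        _ = _ := by rw [hV', Matrix.one_mul, Matrix.mul_one]
    rw [this, Matrix.diagonal_apply_eq]
  set f := weightedDiag Kᶜ (fun j => (μ j)⁻¹) V with hf
  have hsum : ∑ j ∈ Kᶜ, (μ j)⁻¹ * ((Vᵀ * S s * V) j j - μ j) = f (S s) - f (S t) := by
    change _ = ∑ j ∈ Kᶜ, (μ j)⁻¹ * (Vᵀ * S s * V) j j - ∑ j ∈ Kᶜ, (μ j)⁻¹ * (Vᵀ * S t * V) j j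
    rw [← Finset.sum_sub_distrib]
    exact Finset.sum_congr rfl fun j _ => by rw [hdiag, mul_sub]
  have hfint := linearMap_sub_eq_integral (hsub s t h0 h1 h2) (hdiff s t h0 h1 h2) f
  have hlow := intervalIntegral.integral_mono_on h1 intervalIntegrable_const
    (intervalIntegrable_linearMap (hsub s t h0 h1 h2) f) fun r hr =>
      weightedDiag_lower_bound hk (e := L * (t - s))
        (ha r ⟨h0.trans hr.1, hr.2.trans h2⟩) (hU r ⟨h0.trans hr.1, hr.2.trans h2⟩) hV hSV hμ0
        (inv_eigenvalue_le hV hSV hμ0 (hB t ht)) (fun i j => by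
          rw [abs_sub_comm]
          refine (hLip r t (h0.trans hr.1) hr.2 h2 i j).trans ?_
          gcongr
          exact hr.1) hK
  rw [← hfint, intervalIntegral.integral_const, smul_eq_mul] at hlow
  rw [hsum] at hstep
  have hdd : ∑ i, D i i = ∑ i, d i := rfl
  rw [hdd]
  nlinarith [hlow, hstep]

lemma IsReachable.symm {n : ℕ} {T : ℝ} (hT : 0 < T) {D P₀ PT : Matrix (Fin n) (Fin n) ℝ}
    (hreach : IsReachable P₀ PT D T) : IsReachable PT P₀ (-D) T := by
  obtain ⟨U, S, hUm, hU, hS, h0, hTe, hint, hSeq⟩ := hreach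
  have hmem : ∀ t ∈ Set.Icc 0 T, T - t ∈ Set.Icc 0 T := fun t ht =>
    ⟨sub_nonneg.mpr ht.2, sub_le_self _ ht.1⟩
  have hneg : ∀ t, (U t * -D * (U t)ᵀ) * S t + S t * (U t * -D * (U t)ᵀ) =
      -((U t * D * (U t)ᵀ) * S t + S t * (U t * D * (U t)ᵀ)) := fun t => by
    simp only [Matrix.mul_neg, Matrix.neg_mul, neg_add]
  refine ⟨fun t => U (T - t), fun t => S (T - t), fun i j => ?_, fun t ht => hU _ (hmem t ht),
    fun t ht => hS _ (hmem t ht), by simpa using hTe, by simpa using h0, fun i j => ?_,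
    fun t ht i j => ?_⟩
  · exact (hUm i j).comp (measurable_const.sub measurable_id)
  · simp only [hneg, Matrix.neg_apply]
    have := ((hint i j).comp_sub_left T).symm
    rw [sub_self, sub_zero] at this
    exact this.neg
  · simp only [hneg, Matrix.neg_apply]
    rw [intervalIntegral.integral_neg, intervalIntegral.integral_comp_sub_left
      (fun s => ((U s * D * (U s)ᵀ) * S s + S s * (U s * D * (U s)ᵀ)) i j), sub_zero,
      hSeq _ (hmem t ht), ← hTe, hSeq T ⟨hT.le, le_rfl⟩]
    have hsub : IntervalIntegrable
        (fun t => ((U t * D * (U t)ᵀ) * S t + S t * (U t * D * (U t)ᵀ)) i j) volume 0 (T - t) :=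
      (hint i j).mono_set (by
        rw [Set.uIcc_of_le (hmem t ht).1, Set.uIcc_of_le hT.le]
        exact Set.Icc_subset_Icc le_rfl (hmem t ht).2)
    have := intervalIntegral.integral_interval_sub_left (hint i j) hsub
    linarith

lemma IsReachable.log_eigenvalues_isMajorizedBy {n : ℕ} (hn : 1 ≤ n) {T : ℝ} (hT : 0 < T)
    {D P₀ PT : Matrix (Fin n) (Fin n) ℝ} (hD : D.IsDiag)
    (hP₀ : P₀.PosDef) (hPT : PT.PosDef) (hreach : IsReachable P₀ PT D T) :
    IsMajorizedBy (fun i => Real.log (hPT.1.eigenvalues i))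
      (fun i => sortDesc (fun j => Real.log (hP₀.1.eigenvalues j)) i
        + 2 * T * sortDesc D.diag i) := by
  have h0 := hreach.sumSmallLog_sub_le hn hT hD hP₀ hPT
  have h1 := (hreach.symm hT).sumSmallLog_sub_le hn hT hD.neg hPT hP₀
  simp only [sumSmallLog, sumLargest, not_lt_zero, Finset.filter_false, Finset.sum_empty, sub_zero,
    Matrix.neg_apply, Finset.sum_neg_distrib] at h0 h1
  have hdd : ∑ i, D.diag i = ∑ i, D i i := rfl
  have htot : ∑ i, Real.log (hPT.1.eigenvalues i) =
      ∑ i, Real.log (hP₀.1.eigenvalues i) + 2 * T * ∑ i, D i i := by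
    linarith
  refine ⟨?_, fun k hk => ?_⟩
  · rw [Finset.sum_add_distrib, ← Finset.mul_sum, sum_sortDesc, sum_sortDesc, hdd, htot]
  · refine le_trans ?_ (sum_filter_le_sumLargest hk _)
    rw [Finset.sum_add_distrib, ← Finset.mul_sum]
    have h := hreach.sumSmallLog_sub_le hk hT hD hP₀ hPT
    unfold sumSmallLog at h
    change sumLargest k _ ≤ sumLargest k _ + 2 * T * sumLargest k _
    linarith

/-- Corollary 13, two-sided necessary majorization conditions.
If `ΣT ∈ R(Σ₀, D, T)` then `log λ(ΣT) ≺ log λ(Σ₀)↓ + 2T·λ(D)↓` and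
`log λ(Σ₀) ≺ log λ(ΣT)↓ + 2T·λ(−D)↓`. -/
theorem both_log_majorizations_of_isReachable
    {n : ℕ} (hn : 1 ≤ n) (T : ℝ) (hT : 0 < T)
    (D P₀ PT : Matrix (Fin n) (Fin n) ℝ) (hD : D.IsDiag)
    (hP₀ : P₀.PosDef) (hPT : PT.PosDef)
    (hreach : IsReachable P₀ PT D T) :
    IsMajorizedBy (fun i => Real.log (hPT.1.eigenvalues i))
      (fun i => sortDesc (fun j => Real.log (hP₀.1.eigenvalues j)) i
        + 2 * T * sortDesc D.diag i) ∧
    IsMajorizedBy (fun i => Real.log (hP₀.1.eigenvalues i))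
      (fun i => sortDesc (fun j => Real.log (hPT.1.eigenvalues j)) i
        + 2 * T * sortDesc (fun j => -(D j j)) i) := by
  exact ⟨hreach.log_eigenvalues_isMajorizedBy hn hT hD hP₀ hPT,
    (hreach.symm hT).log_eigenvalues_isMajorizedBy hn hT hD.neg hPT hP₀⟩
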